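/- arXiv:1407.0958 — 7 statements merged into one kernel-verified Lean document; each statement's English description precedes it below -/
import Mathlib

section
/- Let G be a finite directed graph with vertex set V and edge set E ⊆ V × V. Suppose that for every ordered pair (u, v) of distinct vertices there is a directed walk p(u,v) from u to v, and a labeling assigning to each position of each walk a time in {1, …, T} such that the times are strictly increasing along each walk and no edge of G is assigned the same time by two different (walk, position) occurrences. Then T · |E| ≥ Σ_{u ≠ v} (length of p(u,v)) ≥ Σ_{u ≠ v} dist(u, v), where dist(u, v) is the length of a shortest directed walk from u to v; consequently T ≥ ⌈(Σ_{u ≠ v} dist(u, v)) / |E|⌉. -/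
/-- `IsWalkLen E u v n` : there is a directed walk of length `n` from `u` to `v`
    using edges of `E`. -/
def IsWalkLen {V : Type*} (E : Finset (V × V)) (u v : V) (n : ℕ) : Prop :=
  ∃ f : Fin (n + 1) → V, f 0 = u ∧ f (Fin.last n) = v ∧
    ∀ i : Fin n, (f i.castSucc, f i.succ) ∈ E

/-- `walkDist E u v` : the length of a shortest directed walk from `u` to `v`. -/
noncomputable def walkDist {V : Type*} (E : Finset (V × V)) (u v : V) : ℕ :=
  sInf {n | IsWalkLen E u v n}

theorem IsWalkLen.walkDist_le {V : Type*} {E : Finset (V × V)} {u v : V} {n : ℕ}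
    (h : IsWalkLen E u v n) : walkDist E u v ≤ n :=
  Nat.sInf_le h

/-- Lemma 1. If on a finite directed graph `(V, E)` there is, for every
ordered pair of distinct vertices, a directed walk `p(u,v)` from `u` to `v` together with a
time labeling in `{1, …, T}` that is strictly increasing along each walk and never assigns
the same time twice to the same edge, then
`T·|E| ≥ Σ_{u≠v} length(p(u,v)) ≥ Σ_{u≠v} dist(u,v)`, and hence
`T ≥ ⌈(Σ_{u≠v} dist(u,v)) / |E|⌉`. -/
theorem transpose_time_lower_bound
    {V : Type*} [Fintype V] [DecidableEq V] (E : Finset (V × V)) (T : ℕ)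
    (L : V → V → ℕ) (f : ∀ u v : V, Fin (L u v + 1) → V)
    (t : ∀ u v : V, Fin (L u v) → ℕ)
    (hstart : ∀ u v : V, u ≠ v → f u v 0 = u)
    (hend : ∀ u v : V, u ≠ v → f u v (Fin.last (L u v)) = v)
    (hedge : ∀ u v : V, u ≠ v → ∀ i : Fin (L u v),
      (f u v i.castSucc, f u v i.succ) ∈ E)
    (htime : ∀ u v : V, u ≠ v → ∀ i : Fin (L u v), 1 ≤ t u v i ∧ t u v i ≤ T)
    (hmono : ∀ u v : V, u ≠ v → StrictMono (t u v))
    (hconflict : ∀ u₁ v₁ u₂ v₂ : V, u₁ ≠ v₁ → u₂ ≠ v₂ →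
      ∀ (j : Fin (L u₁ v₁)) (k : Fin (L u₂ v₂)),
        (f u₁ v₁ j.castSucc, f u₁ v₁ j.succ) = (f u₂ v₂ k.castSucc, f u₂ v₂ k.succ) →
        t u₁ v₁ j = t u₂ v₂ k →
        u₁ = u₂ ∧ v₁ = v₂ ∧ (j : ℕ) = (k : ℕ)) :
    (∑ u : V, ∑ v : V, if u ≠ v then walkDist E u v else 0) ≤
      (∑ u : V, ∑ v : V, if u ≠ v then L u v else 0) ∧
    (∑ u : V, ∑ v : V, if u ≠ v then L u v else 0) ≤ T * E.card ∧
    (⌈((∑ u : V, ∑ v : V, if u ≠ v then walkDist E u v else 0 : ℕ) : ℚ) /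
        ((E.card : ℕ) : ℚ)⌉ : ℤ) ≤ (T : ℤ) := by
  have hdist : (∑ u : V, ∑ v : V, if u ≠ v then walkDist E u v else 0) ≤
      ∑ u : V, ∑ v : V, if u ≠ v then L u v else 0 := by
    refine Finset.sum_le_sum fun u _ => Finset.sum_le_sum fun v _ => ?_
    split_ifs with h
    · exact IsWalkLen.walkDist_le ⟨f u v, hstart u v h, hend u v h, hedge u v h⟩
    · exact le_rfl
  have hlen : (∑ u : V, ∑ v : V, if u ≠ v then L u v else 0) ≤ T * E.card := by
    let S : Finset (Σ p : V × V, Fin (L p.1 p.2)) :=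
      (Finset.univ.filter fun p : V × V => p.1 ≠ p.2).sigma fun _ => Finset.univ
    have hS : S.card = ∑ u : V, ∑ v : V, if u ≠ v then L u v else 0 := by
      simp only [S, Finset.card_sigma, Finset.card_univ, Fintype.card_fin, Finset.sum_filter,
        Fintype.sum_prod_type]
    have hcard : (Finset.Icc 1 T ×ˢ E).card = T * E.card := by simp
    rw [← hS, ← hcard]
    refine Finset.card_le_card_of_injOn
      (fun x => (t x.1.1 x.1.2 x.2, (f x.1.1 x.1.2 x.2.castSucc, f x.1.1 x.1.2 x.2.succ))) ?_ ?_
    · rintro ⟨⟨u, v⟩, i⟩ hx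
      have huv : u ≠ v := by simpa [S] using hx
      exact Finset.mem_product.2 ⟨Finset.mem_Icc.2 (htime u v huv i), hedge u v huv i⟩
    · rintro ⟨⟨u₁, v₁⟩, j⟩ hx ⟨⟨u₂, v₂⟩, k⟩ hy hxy
      have h₁ : u₁ ≠ v₁ := by simpa [S] using hx
      have h₂ : u₂ ≠ v₂ := by simpa [S] using hy
      obtain ⟨ht, he⟩ := Prod.ext_iff.1 hxy
      obtain ⟨rfl, rfl, hjk⟩ := hconflict u₁ v₁ u₂ v₂ h₁ h₂ j k he ht
      rw [Fin.ext hjk]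
  refine ⟨hdist, hlen, Int.ceil_le.2 (div_le_of_le_mul₀ (by positivity) (by positivity) ?_)⟩
  exact_mod_cast hdist.trans hlen
end

section
/- Let Γ be a group and Δ ⊆ Γ. Suppose for each g ∈ Γ we are given a word w(g), i.e., a finite list of elements of Δ whose product is g, and a time function t assigning a natural number to each position of each word w(g), such that for every δ ∈ Δ the times assigned to the occurrences of δ (over all words w(g) and all positions) are pairwise distinct. For h ∈ Γ the translated path h·w(g) has as its j-th edge the pair (h·p_j, h·p_j·δ_j), where p_j is the product of the first j−1 letters of w(g) and δ_j is its j-th letter. Then for all h₁, h₂, g₁, g₂ ∈ Γ and positions j in w(g₁), k in w(g₂): if the j-th edge of h₁·w(g₁) equals the k-th edge of h₂·w(g₂) and t(g₁, j) = t(g₂, k), then g₁ = g₂, j = k, and h₁ = h₂. In particular, no edge of the Cayley graph receives the same time twice in the collection of all translated paths. -/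
/-- Theorem 2. Let `Γ` be a group and `Δ ⊆ Γ`. Suppose each `g ∈ Γ` is
given a word `w g` over `Δ` with product `g`, and a time labeling of the positions of the
words such that, for every generator `δ`, all occurrences of `δ` (over all words and
positions) get pairwise distinct times. Translating the path determined by `w g` by
`h ∈ Γ`, the `j`-th edge of `h·w(g)` is `(h·p_j, h·p_j·δ_j)` where `p_j` is the product of
the first `j` letters and `δ_j` the `j`-th letter. Then if an edge of `h₁·w(g₁)` at
position `j` coincides with an edge of `h₂·w(g₂)` at position `k` and carries the same
time, we must have `g₁ = g₂`, `j = k` and `h₁ = h₂`; in particular no edge of the Cayley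
graph receives the same time twice. -/
theorem cayley_translated_paths_no_conflict
    {Γ : Type*} [Group Γ] (Δ : Set Γ)
    (w : Γ → List Γ)
    (hw : ∀ g : Γ, (∀ x ∈ w g, x ∈ Δ) ∧ (w g).prod = g)
    (t : ∀ g : Γ, Fin (w g).length → ℕ)
    (ht : ∀ (g₁ g₂ : Γ) (j : Fin (w g₁).length) (k : Fin (w g₂).length),
      (w g₁).get j = (w g₂).get k → t g₁ j = t g₂ k →
      g₁ = g₂ ∧ (j : ℕ) = (k : ℕ)) :
    ∀ (h₁ h₂ g₁ g₂ : Γ) (j : Fin (w g₁).length) (k : Fin (w g₂).length),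
      (h₁ * ((w g₁).take (j : ℕ)).prod,
        h₁ * ((w g₁).take (j : ℕ)).prod * (w g₁).get j) =
      (h₂ * ((w g₂).take (k : ℕ)).prod,
        h₂ * ((w g₂).take (k : ℕ)).prod * (w g₂).get k) →
      t g₁ j = t g₂ k →
      g₁ = g₂ ∧ (j : ℕ) = (k : ℕ) ∧ h₁ = h₂ := by
  intro h₁ h₂ g₁ g₂ j k hedge htime
  obtain ⟨hsource, htarget⟩ := Prod.mk.inj hedge
  rw [hsource] at htarget
  obtain ⟨rfl, hjk⟩ := ht g₁ g₂ j k (mul_left_cancel htarget) htime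
  rw [hjk] at hsource
  exact ⟨rfl, hjk, mul_right_cancel hsource⟩
end

section
/- Let V be a finite set, d ≥ 1, and let F₁, …, F_d be permutations of V that are edge-disjoint, i.e., F_i(v) ≠ F_j(v) for all v ∈ V and i ≠ j. Let (ω_a)_{a ∈ ι} be a family of words over the alphabet {1, …, d}, and let t be a schedule: an assignment of a time to each position of each word such that times strictly increase along each word and, for each index i, the times assigned to the occurrences of the letter i (over all words and positions) are pairwise distinct. For v ∈ V and a word ω, let vω denote the directed path obtained by starting at v and following, for each successive letter i of ω, the edge (u, F_i(u)) from the current vertex u. Then no edge (u, F_i(u)) is assigned the same time twice over the whole collection of paths {vω_a : v ∈ V, a ∈ ι}: if position j of the path v₁ω_a and position k of the path v₂ω_b traverse the same edge with the same time, then a = b, j = k, and v₁ = v₂. -/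
/-- The vertex reached from `v` after following the factors named by the word `ω`. -/
def pathVertex {V : Type*} {d : ℕ} (F : Fin d → Equiv.Perm V) (v : V)
    (ω : List (Fin d)) : V :=
  ω.foldl (fun u i => F i u) v

/-- Following a fixed word is injective in the starting vertex. -/
theorem pathVertex_injective {V : Type*} {d : ℕ} (F : Fin d → Equiv.Perm V)
    (ω : List (Fin d)) : Function.Injective fun v => pathVertex F v ω := by
  induction ω with
  | nil => exact Function.injective_id
  | cons i ω ih => exact ih.comp (F i).injective

/-- Theorem 3, first part. Let `F₁, …, F_d` be edge-disjoint
permutations of a finite set `V` (`Fᵢ(v) ≠ Fⱼ(v)` for `i ≠ j`), let `(ω_a)` be a family of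
words over the alphabet `{1, …, d}`, and let `t` be a schedule: times strictly increase
along each word and, for each letter `i`, the occurrences of `i` over all words get
pairwise distinct times. Then in the collection of paths `{vω_a}` no edge `(u, Fᵢ(u))` is
assigned the same time twice: if position `j` of `v₁ω_a` and position `k` of `v₂ω_b`
traverse the same edge with the same time then `a = b`, `j = k` and `v₁ = v₂`. -/
theorem factorization_schedule_no_conflict
    {V : Type*} [Fintype V] {ι : Type*} (d : ℕ) (hd : 1 ≤ d)
    (F : Fin d → Equiv.Perm V)
    (hdisj : ∀ (v : V) (i j : Fin d), i ≠ j → F i v ≠ F j v)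
    (ω : ι → List (Fin d))
    (t : ∀ a : ι, Fin (ω a).length → ℕ)
    (hmono : ∀ a : ι, StrictMono (t a))
    (ht : ∀ (a b : ι) (j : Fin (ω a).length) (k : Fin (ω b).length),
      (ω a).get j = (ω b).get k → t a j = t b k → a = b ∧ (j : ℕ) = (k : ℕ)) :
    ∀ (v₁ v₂ : V) (a b : ι) (j : Fin (ω a).length) (k : Fin (ω b).length),
      (pathVertex F v₁ ((ω a).take (j : ℕ)),
        F ((ω a).get j) (pathVertex F v₁ ((ω a).take (j : ℕ)))) =
      (pathVertex F v₂ ((ω b).take (k : ℕ)),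
        F ((ω b).get k) (pathVertex F v₂ ((ω b).take (k : ℕ)))) →
      t a j = t b k →
      a = b ∧ (j : ℕ) = (k : ℕ) ∧ v₁ = v₂ := by
  intro v₁ v₂ a b j k hedge htime
  obtain ⟨htail, hhead⟩ := Prod.mk.inj hedge
  have hletter : (ω a).get j = (ω b).get k := by
    by_contra hne
    exact hdisj _ _ _ hne (hhead.trans (congrArg _ htail.symm))
  obtain ⟨rfl, hjk⟩ := ht a b j k hletter htime
  rw [hjk] at htail
  exact ⟨rfl, hjk, pathVertex_injective F _ htail⟩
end

section
/- Consider d ≥ 1 machines, a finite set J₁ of one-step jobs with machine assignment m : J₁ → {1, …, d}, and a finite set J₂ of two-step jobs with machine assignments a, b : J₂ → {1, …, d} for the first and second steps respectively. Let T = ⌈(|J₁| + 2|J₂|)/d⌉, and define the load of a machine μ as |m⁻¹(μ)| + |a⁻¹(μ)| + |b⁻¹(μ)|. A schedule in time T consists of functions s : J₁ → {1, …, T} and s₁, s₂ : J₂ → {1, …, T} with s₁(j) < s₂(j) for every j ∈ J₂, such that no machine is assigned two steps with the same time (the times of all steps assigned to any fixed machine are pairwise distinct). Then a schedule in time T exists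 if and only if every machine has load at most T and no machine with load exactly T is assigned exclusively first steps of two-step jobs or exclusively second steps of two-step jobs. -/
open Finset

section Konig

variable {V E : Type*} [Fintype V] [DecidableEq V]

/-- A finite set of edges of positive regular degree in a bipartite multigraph (with endpoint maps
`a`, `b`) contains a perfect matching. -/
theorem exists_perfect_matching_of_regular (a b : E → V) (D : ℕ) (S : Finset E)
    (ha : ∀ v, #{e ∈ S | a e = v} = D + 1) (hb : ∀ v, #{e ∈ S | b e = v} = D + 1) :
    ∃ g : V → E, (∀ v, g v ∈ S) ∧ (∀ v, a (g v) = v) ∧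
      Function.Bijective fun v => b (g v) := by
  have hall : ∀ A : Finset V, #A ≤ #(A.biUnion fun v => {e ∈ S | a e = v}.image b) := by
    intro A
    set N := A.biUnion fun v => {e ∈ S | a e = v}.image b with hN
    have hA : #{e ∈ S | a e ∈ A} = #A * (D + 1) := by
      rw [card_eq_sum_card_fiberwise (f := a) (t := A) (fun e he => by simp_all)]
      rw [sum_const_nat]
      intro v hv
      rw [← ha v, filter_filter]
      congr 1
      ext e
      simp only [mem_filter]
      grind
    have hB : #{e ∈ S | b e ∈ N} = #N * (D + 1) := by
      rw [card_eq_sum_card_fiberwise (f := b) (t := N) (fun e he => by simp_all)]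
      rw [sum_const_nat]
      intro v hv
      rw [← hb v, filter_filter]
      congr 1
      ext e
      simp only [mem_filter]
      grind
    have hsub : {e ∈ S | a e ∈ A} ⊆ {e ∈ S | b e ∈ N} := by
      intro e he
      simp only [mem_filter] at he ⊢
      refine ⟨he.1, ?_⟩
      rw [hN, mem_biUnion]
      exact ⟨a e, he.2, mem_image_of_mem b (by simp [he.1])⟩
    have := card_le_card hsub
    rw [hA, hB] at this
    exact Nat.le_of_mul_le_mul_right this D.succ_pos
  obtain ⟨f, hf, hfm⟩ := (all_card_le_biUnion_card_iff_exists_injective _).1 hall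
  simp only [mem_image, mem_filter] at hfm
  choose g hg hgf using hfm
  refine ⟨g, fun v => (hg v).1, fun v => (hg v).2, ?_⟩
  simp only [hgf]
  exact Finite.injective_iff_bijective.1 hf

/-- **König's edge colouring theorem** for regular bipartite multigraphs. -/
theorem exists_edge_coloring_of_regular [DecidableEq E] (a b : E → V) (D : ℕ) (S : Finset E)
    (ha : ∀ v, #{e ∈ S | a e = v} = D) (hb : ∀ v, #{e ∈ S | b e = v} = D) :
    ∃ c : E → ℕ, (∀ e ∈ S, c e < D) ∧
      ∀ e ∈ S, ∀ e' ∈ S, (a e = a e' ∨ b e = b e') → c e = c e' → e = e' := by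
  induction D generalizing S with
  | zero =>
    have hS : S = ∅ := by
      refine eq_empty_of_forall_notMem fun e he => ?_
      have := ha (a e)
      rw [card_eq_zero] at this
      exact notMem_empty e (this ▸ mem_filter.2 ⟨he, rfl⟩)
    subst hS
    exact ⟨fun _ => 0, by simp, by simp⟩
  | succ D ih =>
    obtain ⟨g, hgS, hga, hgb⟩ := exists_perfect_matching_of_regular a b D S ha hb
    have hM : ∀ e, e ∈ univ.image g ↔ e = g (a e) := by
      intro e
      simp only [mem_image, mem_univ, true_and]
      constructor
      · rintro ⟨v, rfl⟩
        rw [hga]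
      · exact fun h => ⟨a e, h.symm⟩
    obtain ⟨c, hc, hcinj⟩ := ih (S \ univ.image g)
      (by
        intro v
        have h : {e ∈ S \ univ.image g | a e = v} = {e ∈ S | a e = v}.erase (g v) := by
          ext e
          simp only [mem_filter, mem_sdiff, hM, mem_erase]
          grind
        rw [h, card_erase_of_mem (by simp [hgS, hga]), ha v, Nat.add_sub_cancel])
      (by
        intro v
        obtain ⟨u, hu⟩ := hgb.2 v
        have h : {e ∈ S \ univ.image g | b e = v} = {e ∈ S | b e = v}.erase (g u) := by
          ext e
          simp only [mem_filter, mem_sdiff, hM, mem_erase]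
          constructor
          · rintro ⟨⟨h1, h2⟩, h3⟩
            exact ⟨fun h => h2 (by rw [h, hga]), h1, h3⟩
          · rintro ⟨h1, h2, h3⟩
            refine ⟨⟨h2, fun h => h1 ?_⟩, h3⟩
            have : a e = u := hgb.1 (by simp only [← h, h3]; exact hu.symm)
            rw [h, this]
        rw [h, card_erase_of_mem (by simpa [hgS] using hu), hb v, Nat.add_sub_cancel])
    refine ⟨fun e => if e = g (a e) then D else c e, fun e he => ?_, fun e he e' he' hab => ?_⟩
    · dsimp only
      split_ifs with h
      · exact D.lt_succ_self
      · exact (hc e (mem_sdiff.2 ⟨he, fun h' => h ((hM e).1 h')⟩)).trans D.lt_succ_self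
    · have key : ∀ x ∈ S, x ≠ g (a x) → x ∈ S \ univ.image g := fun x hx h =>
        mem_sdiff.2 ⟨hx, fun h' => h ((hM x).1 h')⟩
      dsimp only
      split_ifs with h h' h'
      · intro _
        rcases hab with hab | hab
        · rw [h, h', hab]
        · have : a e = a e' := hgb.1 (by simp only [← h, ← h', hab])
          rw [h, h', this]
      · intro h2
        exact absurd h2.symm (hc e' (key e' he' h')).ne
      · intro h2
        exact absurd h2 (hc e (key e he h)).ne
      · exact hcinj e (key e he h) e' (key e' he' h') hab

/-- **König's edge colouring theorem** for bipartite multigraphs whose two sides are copies of the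
same vertex set: maximum degree at most `D` implies that `D` colours suffice. -/
theorem exists_edge_coloring_of_degree_le [Fintype E] [DecidableEq E] (a b : E → V) (D : ℕ)
    (ha : ∀ v, #{e | a e = v} ≤ D) (hb : ∀ v, #{e | b e = v} ≤ D) :
    ∃ c : E → ℕ, (∀ e, c e < D) ∧ ∀ e e', (a e = a e' ∨ b e = b e') → c e = c e' → e = e' := by
  let L := Σ v : V, Fin (D - #{e | a e = v})
  let R := Σ v : V, Fin (D - #{e | b e = v})
  have deficit : ∀ f : E → V, (∀ v, #{e | f e = v} ≤ D) →
      ∑ v, (D - #{e | f e = v}) + Fintype.card E = Fintype.card V * D := by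
    intro f hf
    have h : Fintype.card E = ∑ v, #{e | f e = v} :=
      card_eq_sum_card_fiberwise fun _ _ => mem_coe.2 (mem_univ _)
    rw [h, ← sum_add_distrib, sum_congr rfl fun v _ => Nat.sub_add_cancel (hf v)]
    simp
  have hLR : Fintype.card L = Fintype.card R := by
    have h1 := deficit a ha
    have h2 := deficit b hb
    simp only [L, R, Fintype.card_sigma, Fintype.card_fin]
    omega
  let φ : L ≃ R := Fintype.equivOfCardEq hLR
  have fiber : ∀ k : V → ℕ, ∀ v, #{x : Σ v : V, Fin (k v) | x.1 = v} = k v := by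
    intro k v
    have : ({x | x.1 = v} : Finset (Σ v : V, Fin (k v))) = univ.map (Function.Embedding.sigmaMk v) := by
      ext ⟨w, i⟩
      simp only [mem_filter, mem_univ, true_and, mem_map, Function.Embedding.sigmaMk_apply]
      constructor
      · rintro rfl
        exact ⟨i, rfl⟩
      · rintro ⟨j, hj⟩
        exact (congrArg Sigma.fst hj).symm
    rw [this, card_map, card_univ, Fintype.card_fin]
  have split : ∀ f : E → V, ∀ h : L → V, ∀ v,
      #{x : E ⊕ L | Sum.elim f h x = v} = #{e | f e = v} + #{x | h x = v} := by
    intro f h v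
    rw [← card_disjSum]
    congr 1
    ext (x | x) <;> simp
  obtain ⟨c, hc, hcinj⟩ := exists_edge_coloring_of_regular
    (Sum.elim a fun x : L => x.1) (Sum.elim b fun x : L => (φ x).1) D univ
    (by
      intro v
      rw [split, fiber, Nat.add_sub_cancel' (ha v)])
    (by
      intro v
      have h : #{x : L | (φ x).1 = v} = #{y : R | y.1 = v} :=
        card_equiv φ (by simp)
      rw [split, h, fiber, Nat.add_sub_cancel' (hb v)])
  exact ⟨fun e => c (.inl e), fun e => hc _ (mem_univ _), fun e e' hab h =>
    Sum.inl_injective (hcinj _ (mem_univ _) _ (mem_univ _) hab h)⟩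

end Konig

section FiberRank

variable {J V : Type*} [Fintype J] [DecidableEq V]

/-- The position, counted from one, of `j` in its `f`-fiber ordered by `c`. -/
def fiberRank (f : J → V) (c : J → ℕ) (j : J) : ℕ := #{i | f i = f j ∧ c i ≤ c j}

theorem one_le_fiberRank (f : J → V) (c : J → ℕ) (j : J) : 1 ≤ fiberRank f c j :=
  card_pos.2 ⟨j, by simp⟩

theorem fiberRank_le_card (f : J → V) (c : J → ℕ) (j : J) :
    fiberRank f c j ≤ #{i | f i = f j} :=
  card_le_card fun i hi => by
    simp only [mem_filter, mem_univ, true_and] at hi ⊢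
    exact hi.1

theorem fiberRank_le_succ (f : J → V) (c : J → ℕ)
    (hc : ∀ i j, f i = f j → c i = c j → i = j) (j : J) : fiberRank f c j ≤ c j + 1 := by
  have : fiberRank f c j ≤ #(range (c j + 1)) := by
    refine card_le_card_of_injOn c (fun i hi => ?_) fun i hi i' hi' h => ?_
    · simp only [coe_filter, mem_univ, true_and, Set.mem_ofPred_eq] at hi
      simp only [coe_range, Set.mem_Iio]
      omega
    · simp only [coe_filter, mem_univ, true_and, Set.mem_ofPred_eq] at hi hi'
      exact hc i i' (hi.1.trans hi'.1.symm) h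
  rwa [card_range] at this

theorem fiberRank_lt_fiberRank (f : J → V) (c : J → ℕ) {i j : J} (hf : f i = f j)
    (h : c i < c j) : fiberRank f c i < fiberRank f c j := by
  refine card_lt_card ((ssubset_iff_of_subset fun x hx => ?_).2 ⟨j, ?_, ?_⟩)
  · simp only [mem_filter, mem_univ, true_and] at hx ⊢
    exact ⟨hx.1.trans hf, hx.2.trans h.le⟩
  · simp
  · simp [h]

theorem fiberRank_inj (f : J → V) (c : J → ℕ)
    (hc : ∀ i j, f i = f j → c i = c j → i = j) (i j : J) (hf : f i = f j)
    (h : fiberRank f c i = fiberRank f c j) : i = j := by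
  rcases lt_trichotomy (c i) (c j) with h' | h' | h'
  · exact absurd h (fiberRank_lt_fiberRank f c hf h').ne
  · exact hc i j hf h'
  · exact absurd h (fiberRank_lt_fiberRank f c hf.symm h').ne'

end FiberRank

theorem forall_ne_of_card_fiber_eq_zero {J V : Type*} [Fintype J] [DecidableEq V] (f : J → V)
    (v : V) (h : #{j | f j = v} = 0) (j : J) : f j ≠ v := by
  rw [card_eq_zero, filter_eq_empty_iff] at h
  exact h (mem_univ j)

/-- A set on which `t` is injective with values in `{k, …, l}` has at most `l + 1 - k` elements. -/
theorem card_le_of_injOn_Icc {J : Type*} (F : Finset J) (t : J → ℕ) (k l : ℕ)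
    (ht : ∀ j ∈ F, k ≤ t j ∧ t j ≤ l) (hinj : ∀ i ∈ F, ∀ j ∈ F, t i = t j → i = j) :
    #F ≤ l + 1 - k := by
  rw [← Nat.card_Icc]
  exact card_le_card_of_injOn t (fun j hj => by simpa using ht j hj)
    fun i hi j hj h => hinj i hi j hj h


/-- Corollary 4 of [6]. With `d ≥ 1` machines, a finite set `J₁` of
one-step jobs (machine assignment `m`) and a finite set `J₂` of two-step jobs (machine
assignments `a`, `b` for the first and second step), let `T = ⌈(|J₁| + 2|J₂|)/d⌉` and let
the load of machine `μ` be `|m⁻¹(μ)| + |a⁻¹(μ)| + |b⁻¹(μ)|`. Then a schedule in time `T`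
(times in `{1, …, T}`, the two steps of each two-step job in increasing order, no machine
given two steps at the same time) exists if and only if every machine has load at most
`T` and no machine of load exactly `T` is assigned exclusively first steps of two-step
jobs or exclusively second steps of two-step jobs. -/
theorem unit_time_two_step_schedule_iff
    {J₁ J₂ : Type*} [Fintype J₁] [Fintype J₂] [DecidableEq J₁] [DecidableEq J₂]
    (d : ℕ) (hd : 1 ≤ d)
    (m : J₁ → Fin d) (a b : J₂ → Fin d)
    (T : ℕ) (hT : T = (Fintype.card J₁ + 2 * Fintype.card J₂ + d - 1) / d)
    (load : Fin d → ℕ)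
    (hload : ∀ μ : Fin d, load μ =
      (Finset.univ.filter fun j : J₁ => m j = μ).card +
      (Finset.univ.filter fun j : J₂ => a j = μ).card +
      (Finset.univ.filter fun j : J₂ => b j = μ).card) :
    (∃ (s : J₁ → ℕ) (s₁ s₂ : J₂ → ℕ),
      (∀ j : J₁, 1 ≤ s j ∧ s j ≤ T) ∧
      (∀ j : J₂, 1 ≤ s₁ j ∧ s₁ j ≤ T) ∧
      (∀ j : J₂, 1 ≤ s₂ j ∧ s₂ j ≤ T) ∧
      (∀ j : J₂, s₁ j < s₂ j) ∧
      (∀ j j' : J₁, m j = m j' → s j = s j' → j = j') ∧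
      (∀ j j' : J₂, a j = a j' → s₁ j = s₁ j' → j = j') ∧
      (∀ j j' : J₂, b j = b j' → s₂ j = s₂ j' → j = j') ∧
      (∀ (j : J₁) (j' : J₂), m j = a j' → s j ≠ s₁ j') ∧
      (∀ (j : J₁) (j' : J₂), m j = b j' → s j ≠ s₂ j') ∧
      (∀ j j' : J₂, a j = b j' → s₁ j ≠ s₂ j')) ↔
    ((∀ μ : Fin d, load μ ≤ T) ∧
      (∀ μ : Fin d, load μ = T →
        ¬ (((∃ j : J₂, a j = μ) ∧ (∀ j : J₁, m j ≠ μ) ∧ (∀ j : J₂, b j ≠ μ)) ∨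
           ((∃ j : J₂, b j = μ) ∧ (∀ j : J₁, m j ≠ μ) ∧ (∀ j : J₂, a j ≠ μ))))) := by
  constructor
  · rintro ⟨s, s₁, s₂, hs, hs₁, hs₂, hlt, hi, hi₁, hi₂, h₀₁, h₀₂, h₁₂⟩
    refine ⟨fun μ => ?_, fun μ hμ => ?_⟩
    · rw [hload μ, ← card_disjSum, ← card_disjSum]
      refine card_le_of_injOn_Icc _ (Sum.elim (Sum.elim s s₁) s₂) 1 T ?_ ?_
      · rintro ((j | j) | j) _
        exacts [hs j, hs₁ j, hs₂ j]
      · rintro ((i | i) | i) hin ((j | j) | j) hjn h <;>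
          simp only [inl_mem_disjSum, inr_mem_disjSum, mem_filter, mem_univ, true_and,
            Sum.elim_inl, Sum.elim_inr] at hin hjn h
        · rw [hi i j (hin.trans hjn.symm) h]
        · exact absurd h (h₀₁ i j (hin.trans hjn.symm))
        · exact absurd h (h₀₂ i j (hin.trans hjn.symm))
        · exact absurd h.symm (h₀₁ j i (hjn.trans hin.symm))
        · rw [hi₁ i j (hin.trans hjn.symm) h]
        · exact absurd h (h₁₂ i j (hin.trans hjn.symm))
        · exact absurd h.symm (h₀₂ j i (hjn.trans hin.symm))
        · exact absurd h.symm (h₁₂ j i (hjn.trans hin.symm))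
        · rw [hi₂ i j (hin.trans hjn.symm) h]
    · rw [hload μ] at hμ
      rintro (⟨⟨j, hj⟩, hm, hb⟩ | ⟨⟨j, hj⟩, hm, ha⟩)
      · have hcard := card_le_of_injOn_Icc {j | a j = μ} s₁ 1 (T - 1)
          (fun j _ => by have := hs₁ j; have := hs₂ j; have := hlt j; omega)
          (fun i hin j hjn h => by
            simp only [mem_filter, mem_univ, true_and] at hin hjn
            exact hi₁ i j (hin.trans hjn.symm) h)
        simp only [hm, hb, filter_false, card_empty] at hμ
        have := hs₁ j
        omega
      · have hcard := card_le_of_injOn_Icc {j | b j = μ} s₂ 2 T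
          (fun j _ => by have := hs₁ j; have := hs₂ j; have := hlt j; omega)
          (fun i hin j hjn h => by
            simp only [mem_filter, mem_univ, true_and] at hin hjn
            exact hi₂ i j (hin.trans hjn.symm) h)
        simp only [hm, ha, filter_false, card_empty] at hμ
        have := hs₁ j
        omega
  · rintro ⟨hle, hex⟩
    have hsum : ∀ μ, #{j | m j = μ} + #{j | a j = μ} + #{j | b j = μ} ≤ T := fun μ =>
      hload μ ▸ hle μ
    have hdeg : ∀ μ, #{j | a j = μ} ≤ T - 1 ∧ #{j | b j = μ} ≤ T - 1 := by
      intro μ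
      have h := hsum μ
      by_contra hcon
      refine hex μ (by rw [hload μ]; omega) ?_
      have some_of : ∀ f : J₂ → Fin d, 0 < #{j | f j = μ} → ∃ j, f j = μ := fun f h0 => by
        obtain ⟨j, hj⟩ := card_pos.1 h0
        exact ⟨j, by simpa using hj⟩
      by_cases ha : #{j | a j = μ} ≤ T - 1
      · exact .inr ⟨some_of b (by omega), forall_ne_of_card_fiber_eq_zero m μ (by omega),
          forall_ne_of_card_fiber_eq_zero a μ (by omega)⟩
      · exact .inl ⟨some_of a (by omega), forall_ne_of_card_fiber_eq_zero m μ (by omega),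
          forall_ne_of_card_fiber_eq_zero b μ (by omega)⟩
    obtain ⟨c, hcD, hc⟩ := exists_edge_coloring_of_degree_le a b (T - 1)
      (fun μ => (hdeg μ).1) (fun μ => (hdeg μ).2)
    let e : J₁ → ℕ := fun j => Fintype.equivFin J₁ j
    have he : ∀ i j, m i = m j → e i = e j → i = j := fun i j _ h =>
      (Fintype.equivFin J₁).injective (Fin.ext h)
    have hca : ∀ i j, a i = a j → c i = c j → i = j := fun i j h => hc i j (.inl h)
    have hcb : ∀ i j, b i = b j → T - 2 - c i = T - 2 - c j → i = j := fun i j h h' =>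
      hc i j (.inr h) (by have := hcD i; have := hcD j; omega)
    let r₀ := fiberRank m e
    let r₁ := fiberRank a c
    let r₂ := fiberRank b fun j => T - 2 - c j
    have p₀ : ∀ j, 1 ≤ r₀ j ∧ r₀ j ≤ #{i | m i = m j} := fun j =>
      ⟨one_le_fiberRank _ _ j, fiberRank_le_card _ _ j⟩
    have p₁ : ∀ j, 1 ≤ r₁ j ∧ r₁ j ≤ #{i | a i = a j} := fun j =>
      ⟨one_le_fiberRank _ _ j, fiberRank_le_card _ _ j⟩
    have p₂ : ∀ j, 1 ≤ r₂ j ∧ r₂ j ≤ #{i | b i = b j} := fun j =>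
      ⟨one_le_fiberRank _ _ j, fiberRank_le_card _ _ j⟩
    refine ⟨fun j => #{i | a i = m j} + r₀ j, r₁, fun j => T + 1 - r₂ j,
      fun j => ?_, fun j => ?_, fun j => ?_, fun j => ?_, fun i j hm h => ?_,
      fiberRank_inj a c hca, fun i j hb h => ?_, fun i j hm h => ?_, fun i j hm h => ?_,
      fun i j hab h => ?_⟩
    · have := p₀ j; have := hsum (m j); dsimp only; omega
    · have := p₁ j; have := hsum (a j); omega
    · have := p₂ j; have := hsum (b j); dsimp only; omega
    · have h1 : r₁ j ≤ c j + 1 := fiberRank_le_succ a c hca j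
      have h2 : r₂ j ≤ T - 2 - c j + 1 := fiberRank_le_succ b _ hcb j
      have := hcD j
      dsimp only
      omega
    · simp only [hm] at h
      exact fiberRank_inj m e he i j hm (Nat.add_left_cancel h)
    · refine fiberRank_inj b _ hcb i j hb ?_
      have := p₂ i; have := p₂ j; have := hsum (b i); have := hsum (b j)
      dsimp only at h
      change r₂ i = r₂ j
      rw [hb] at *
      omega
    · have := p₀ i; have := p₁ j
      simp only [hm] at h
      omega
    · have := p₀ i; have := p₂ j; have := hsum (b j)
      simp only [hm] at *
      omega
    · have := p₁ i; have := p₂ j; have := hsum (b j)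
      simp only [hab] at *
      omega
end

section
/- Let F be a finite alphabet of d factors and let (ω_a)_{a ∈ ι} be a finite family of nonempty words over F, each of length 1 or 2. For f ∈ F let load(f) be the total number of occurrences of f in all the words, and let L = max_f load(f) ≥ 1. A schedule in time T assigns to each position of each word a time in {1, …, T} such that the times strictly increase along each word and, for each f ∈ F, the times assigned to the occurrences of f are pairwise distinct. Call a factor f bad if load(f) = L, f does not occur in any word of length 1, and f is entirely absent from one of the two positions of the length-2 words (f never occurs as a first letter, or f never occurs as a second letter). Then: if no factor is bad, the minimum T for which a schedule exists is L; if some factor is bad, the minimum such T is L + 1. -/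
/-- A schedule in time `T` for a family of words: each position of each word gets a time
in `{1, …, T}`, times strictly increase along each word, and for each factor the times of
all of its occurrences are pairwise distinct. -/
def HasSchedule {F ι : Type*} (ω : ι → List F) (T : ℕ) : Prop :=
  ∃ t : ∀ a : ι, Fin (ω a).length → ℕ,
    (∀ (a : ι) (i : Fin (ω a).length), 1 ≤ t a i ∧ t a i ≤ T) ∧
    (∀ a : ι, StrictMono (t a)) ∧
    (∀ (a b : ι) (j : Fin (ω a).length) (k : Fin (ω b).length),
      (ω a).get j = (ω b).get k → t a j = t b k → a = b ∧ (j : ℕ) = (k : ℕ))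

open Finset in
theorem card_filter_mem_of_regular {E F : Type*} [DecidableEq F] (g : E → F) (N : ℕ)
    (S : Finset E) (hg : ∀ u, #{e ∈ S | g e = u} = N) (A : Finset F) :
    #{e ∈ S | g e ∈ A} = #A * N := by
  rw [card_eq_sum_card_fiberwise (f := g) (t := A) (by simp [Set.MapsTo]),
    sum_const_nat (m := N)]
  intro u hu
  rw [← hg u, filter_filter]
  congr 1
  ext e
  simp only [mem_filter]
  constructor
  · rintro ⟨h1, -, h2⟩
    exact ⟨h1, h2⟩
  · rintro ⟨h1, rfl⟩
    exact ⟨h1, hu, rfl⟩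

open Finset in
theorem card_filter_disjSum_elim {E D F : Type*} [DecidableEq F] (g : E → F) (k : D → F)
    (S : Finset E) (R : Finset D) (u : F) :
    #{x ∈ S.disjSum R | Sum.elim g k x = u} = #{e ∈ S | g e = u} + #{d ∈ R | k d = u} := by
  simp only [card_filter, sum_disjSum]
  rfl

open Finset in
/-- A bipartite multigraph (edges `S`, endpoint maps `g` and `h`) that is regular of degree `N`
has a proper edge colouring with `N` colours. -/
theorem exists_edge_coloring_of_regular_s8 {E F : Type*} [DecidableEq E] [Fintype F] [DecidableEq F]
    (g h : E → F) (N : ℕ) (S : Finset E)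
    (hg : ∀ u, #{e ∈ S | g e = u} = N) (hh : ∀ v, #{e ∈ S | h e = v} = N) :
    ∃ c : E → ℕ, (∀ e ∈ S, c e < N) ∧
      ∀ e ∈ S, ∀ e' ∈ S, c e = c e' → g e = g e' ∨ h e = h e' → e = e' := by
  induction N generalizing S with
  | zero =>
    have hS : S = ∅ := by
      refine eq_empty_of_forall_notMem fun e he => ?_
      have := card_eq_zero.1 (hg (g e))
      exact (filter_eq_empty_iff.1 this) he rfl
    subst hS
    exact ⟨fun _ => 0, by simp, by simp⟩
  | succ N ih =>
    obtain ⟨m, hm, hmem⟩ := (all_card_le_biUnion_card_iff_exists_injective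
        (fun u : F => ({e ∈ S | g e = u}).image h)).1 (by
      intro A
      set B := A.biUnion fun u => ({e ∈ S | g e = u}).image h
      have h1 : #{e ∈ S | g e ∈ A} = #A * (N + 1) := card_filter_mem_of_regular g _ S hg A
      have h2 : #{e ∈ S | h e ∈ B} = #B * (N + 1) := card_filter_mem_of_regular h _ S hh B
      have h3 : #{e ∈ S | g e ∈ A} ≤ #{e ∈ S | h e ∈ B} := by
        refine card_le_card fun e he => ?_
        simp only [mem_filter] at he ⊢
        refine ⟨he.1, mem_biUnion.2 ⟨g e, he.2, mem_image.2 ⟨e, ?_, rfl⟩⟩⟩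
        simp [he.1]
      rw [h1, h2] at h3
      exact Nat.le_of_mul_le_mul_right h3 (Nat.succ_pos N))
    have hm' : Function.Surjective m := Finite.surjective_of_injective hm
    simp only [mem_image, mem_filter] at hmem
    choose M hM hMm using hmem
    have key : ∀ u, {e ∈ S \ univ.image M | g e = u} = ({e ∈ S | g e = u}).erase (M u) := by
      intro u
      ext e
      simp only [mem_filter, mem_sdiff, mem_image, mem_univ, true_and, mem_erase, not_exists]
      constructor
      · rintro ⟨⟨h1, h2⟩, h3⟩
        exact ⟨fun h => h2 u h.symm, h1, h3⟩
      · rintro ⟨h1, h2, h3⟩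
        refine ⟨⟨h2, fun x hx => h1 ?_⟩, h3⟩
        have := (hM x).2
        rw [hx, h3] at this
        rw [this, hx]
    have key' : ∀ u, {e ∈ S \ univ.image M | h e = m u} =
        ({e ∈ S | h e = m u}).erase (M u) := by
      intro u
      ext e
      simp only [mem_filter, mem_sdiff, mem_image, mem_univ, true_and, mem_erase, not_exists]
      constructor
      · rintro ⟨⟨h1, h2⟩, h3⟩
        exact ⟨fun h => h2 u h.symm, h1, h3⟩
      · rintro ⟨h1, h2, h3⟩
        refine ⟨⟨h2, fun x hx => h1 ?_⟩, h3⟩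
        have := hMm x
        rw [hx, h3] at this
        rw [hm this, hx]
    obtain ⟨c, hc, hcc⟩ := ih (S \ univ.image M)
      (fun u => by
        rw [key, card_erase_of_mem (by simp [hM u]), hg]; rfl)
      (fun v => by
        obtain ⟨u, rfl⟩ := hm' v
        rw [key', card_erase_of_mem (by simp [(hM u).1, hMm u]), hh]; rfl)
    refine ⟨fun e => if e ∈ univ.image M then N else c e, ?_, ?_⟩
    · intro e he
      by_cases h1 : e ∈ univ.image M
      · simp [h1]
      · have := hc e (mem_sdiff.2 ⟨he, h1⟩)
        simp only [h1, if_false]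
        omega
    · intro e he e' he' h0 hor
      by_cases h1 : e ∈ univ.image M <;> by_cases h2 : e' ∈ univ.image M
      · simp only [mem_image, mem_univ, true_and] at h1 h2
        obtain ⟨x, rfl⟩ := h1
        obtain ⟨y, rfl⟩ := h2
        rcases hor with h | h
        · rw [(hM x).2, (hM y).2] at h
          rw [h]
        · rw [hMm, hMm] at h
          rw [hm h]
      · have := hc e' (mem_sdiff.2 ⟨he', h2⟩)
        simp only [h1, h2, if_true, if_false] at h0
        omega
      · have := hc e (mem_sdiff.2 ⟨he, h1⟩)
        simp only [h1, h2, if_true, if_false] at h0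
        omega
      · simp only [h1, h2, if_false] at h0
        exact hcc e (mem_sdiff.2 ⟨he, h1⟩) e' (mem_sdiff.2 ⟨he', h2⟩) h0 hor

open Finset in
/-- König's theorem: a bipartite multigraph (edges `S`, endpoint maps `g` and `h`) of maximum
degree at most `N` has a proper edge colouring with `N` colours. -/
theorem exists_edge_coloring {E F : Type*} [DecidableEq E] [Fintype F] [DecidableEq F]
    (g h : E → F) (N : ℕ) (S : Finset E)
    (hg : ∀ u, #{e ∈ S | g e = u} ≤ N) (hh : ∀ v, #{e ∈ S | h e = v} ≤ N) :
    ∃ c : E → ℕ, (∀ e ∈ S, c e < N) ∧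
      ∀ e ∈ S, ∀ e' ∈ S, c e = c e' → g e = g e' ∨ h e = h e' → e = e' := by
  have total : ∀ k : E → F, (∀ u, #{e ∈ S | k e = u} ≤ N) →
      ∑ u, (N - #{e ∈ S | k e = u}) + #S = Fintype.card F * N := by
    intro k hk
    rw [card_eq_sum_card_fiberwise (f := k) (t := univ) (by simp [Set.MapsTo]),
      ← sum_add_distrib]
    simp [Nat.sub_add_cancel (hk _)]
  have e : (Σ u, Fin (N - #{e ∈ S | g e = u})) ≃ (Σ v, Fin (N - #{e ∈ S | h e = v})) := by
    refine Fintype.equivOfCardEq ?_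
    have h1 := total g hg
    have h2 := total h hh
    simp only [Fintype.card_sigma, Fintype.card_fin]
    omega
  have fib : ∀ (d : F → ℕ) (u : F), #{x : Σ u, Fin (d u) | x.1 = u} = d u := by
    intro d u
    rw [card_filter, Fintype.sum_sigma, sum_eq_single u]
    · simp
    · intro v _ hv
      simp [hv]
    · simp
  obtain ⟨c, hc, hcc⟩ := exists_edge_coloring_of_regular_s8
    (Sum.elim g fun x : Σ u, Fin (N - #{e ∈ S | g e = u}) => x.1)
    (Sum.elim h fun x => (e x).1) N (S.disjSum univ)
    (fun u => by
      rw [card_filter_disjSum_elim, fib]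
      exact Nat.add_sub_of_le (hg u))
    (fun v => by
      rw [card_filter_disjSum_elim, card_filter (fun x => (e x).1 = v),
        Equiv.sum_comp e (fun x => if x.1 = v then 1 else 0), ← card_filter, fib]
      exact Nat.add_sub_of_le (hh v))
  refine ⟨fun e => c (Sum.inl e), fun e he => hc _ (by simpa using he), ?_⟩
  intro e he e' he' h0 hor
  exact Sum.inl_injective (hcc _ (by simpa using he) _ (by simpa using he') h0 (by simpa using hor))

open Finset in
/-- Labels that are injective on the fibres of `g` can be compressed, within each fibre, to an
initial segment of `ℕ` without increasing any of them. -/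
theorem exists_rank {E F : Type*} [DecidableEq F] (S : Finset E) (g : E → F) (c : E → ℕ)
    (hc : ∀ e ∈ S, ∀ e' ∈ S, g e = g e' → c e = c e' → e = e') :
    ∃ r : E → ℕ, ∀ e ∈ S, r e < #{e' ∈ S | g e' = g e} ∧ r e ≤ c e ∧
      ∀ e' ∈ S, g e = g e' → r e = r e' → e = e' := by
  refine ⟨fun e => #{e' ∈ S | g e' = g e ∧ c e' < c e}, fun e he => ⟨?_, ?_, ?_⟩⟩
  · refine card_lt_card ⟨fun x hx => ?_, fun hsub => ?_⟩
    · simp only [mem_filter] at hx ⊢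
      exact ⟨hx.1, hx.2.1⟩
    · have : e ∈ ({e' ∈ S | g e' = g e} : Finset E) := by simp [he]
      simpa using hsub this
  · calc #{e' ∈ S | g e' = g e ∧ c e' < c e} ≤ #(range (c e)) := by
          refine card_le_card_of_injOn c (fun x hx => ?_) fun x hx y hy hxy => ?_
          · simp at hx ⊢
            exact hx.2.2
          · simp at hx hy
            exact hc x hx.1 y hy.1 (hx.2.1.trans hy.2.1.symm) hxy
      _ = c e := card_range _
  · have mono : ∀ e ∈ S, ∀ e', g e = g e' → c e < c e' →
        #{x ∈ S | g x = g e ∧ c x < c e} < #{x ∈ S | g x = g e' ∧ c x < c e'} := by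
      intro e he e' hg hlt
      refine card_lt_card ⟨fun x hx => ?_, fun hsub => ?_⟩
      · simp only [mem_filter] at hx ⊢
        exact ⟨hx.1, hx.2.1.trans hg, hx.2.2.trans hlt⟩
      · have : e ∈ ({x ∈ S | g x = g e' ∧ c x < c e'} : Finset E) := by simp [he, hg, hlt]
        simpa using hsub this
    intro e' he' hg h0
    rcases lt_trichotomy (c e) (c e') with h | h | h
    · exact absurd h0 (mono e he e' hg h).ne
    · exact hc e he e' he' hg h
    · exact absurd h0 (mono e' he' e hg.symm h).ne'

open Finset in
theorem List.card_filter_get_eq {F : Type*} [DecidableEq F] (f : F) (l : List F) :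
    #{i : Fin l.length | l.get i = f} = l.count f := by
  induction l with
  | nil => simp
  | cons b l ih =>
    rw [List.count_cons, ← ih, card_filter, card_filter]
    erw [Fin.sum_univ_succ]
    simp only [add_comm, beq_iff_eq]
    rfl

open Finset in
/-- If a schedule places all occurrences of `f` at times in `{lo, …, hi}`, then `f` occurs at most
`hi + 1 - lo` times. -/
theorem sum_count_le_of_times_mem_Icc {F ι : Type*} [DecidableEq F] [Fintype ι] (ω : ι → List F)
    (t : ∀ a : ι, Fin (ω a).length → ℕ)
    (ht : ∀ (a b : ι) (j : Fin (ω a).length) (k : Fin (ω b).length),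
      (ω a).get j = (ω b).get k → t a j = t b k → a = b ∧ (j : ℕ) = (k : ℕ))
    (f : F) (lo hi : ℕ) (hf : ∀ a i, (ω a).get i = f → lo ≤ t a i ∧ t a i ≤ hi) :
    ∑ a, (ω a).count f ≤ hi + 1 - lo := by
  have h1 : ∑ a, (ω a).count f = #{x : Σ a, Fin (ω a).length | (ω x.1).get x.2 = f} := by
    rw [card_filter, Fintype.sum_sigma]
    exact sum_congr rfl fun a _ => by rw [← List.card_filter_get_eq, card_filter]
  rw [h1, ← Nat.card_Icc]
  refine card_le_card_of_injOn (fun x => t x.1 x.2) (fun x hx => ?_) ?_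
  · simp only [coe_filter, mem_univ, true_and, Set.mem_ofPred_eq] at hx
    simpa using hf x.1 x.2 hx
  · rintro ⟨a, j⟩ hx ⟨b, k⟩ hy hxy
    simp only [coe_filter, mem_univ, true_and, Set.mem_ofPred_eq] at hx hy
    obtain ⟨rfl, h⟩ := ht a b j k (hx.trans hy.symm) hxy
    rw [Fin.ext h]

open Finset in
/-- A family of words `[x a]` (`a ∉ S`) and `[x a, y a]` (`a ∈ S`) has a schedule in time `N + 1`
as soon as every load is at most `N + 1` and every factor is at most `N` times a first letter
and at most `N` times a second letter of a word of length two. -/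
theorem hasSchedule_succ {F ι : Type*} [Fintype F] [DecidableEq F] [Fintype ι] [DecidableEq ι]
    (ω : ι → List F) (x y : ι → F) (S : Finset ι)
    (hω : ∀ a, ω a = if a ∈ S then [x a, y a] else [x a]) (N : ℕ)
    (hload : ∀ f, #{a ∈ S | x a = f} + #{a ∈ S | y a = f} + #{a ∈ Sᶜ | x a = f} ≤ N + 1)
    (hx : ∀ f, #{a ∈ S | x a = f} ≤ N) (hy : ∀ f, #{a ∈ S | y a = f} ≤ N) :
    HasSchedule ω (N + 1) := by
  obtain ⟨c, hcN, hc⟩ := exists_edge_coloring x y N S hx hy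
  obtain ⟨r, hr⟩ := exists_rank S x c fun e he e' he' h h' => hc e he e' he' h' (.inl h)
  obtain ⟨q, hq⟩ := exists_rank S y (fun e => N - 1 - c e) fun e he e' he' h h' => by
    have h1 := hcN e he
    have h2 := hcN e' he'
    exact hc e he e' he' (by omega) (.inr h)
  obtain ⟨s, hs⟩ := exists_rank Sᶜ x (fun a => (Fintype.equivFin ι a : ℕ)) fun e _ e' _ _ h =>
    (Fintype.equivFin ι).injective (Fin.ext h)
  have hget : ∀ a (j : Fin (ω a).length), (a ∉ S ∧ (j : ℕ) = 0 ∧ (ω a).get j = x a) ∨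
      (a ∈ S ∧ (j : ℕ) = 0 ∧ (ω a).get j = x a) ∨
      (a ∈ S ∧ (j : ℕ) = 1 ∧ (ω a).get j = y a) := by
    intro a
    have h := hω a
    generalize ω a = l at h
    by_cases ha : a ∈ S
    · rw [if_pos ha] at h
      subst h
      intro j
      fin_cases j <;> simp [ha]
    · rw [if_neg ha] at h
      subst h
      intro j
      fin_cases j
      simp [ha]
  refine ⟨fun a j => if a ∈ S then (if (j : ℕ) = 0 then r a + 1 else N + 1 - q a)
    else #{b ∈ S | x b = x a} + 1 + s a, ?_, ?_, ?_⟩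
  · intro a j
    have hl := hload (x a)
    by_cases ha : a ∈ S
    · have h1 := hr a ha
      have h2 := hq a ha
      have h3 := hcN a ha
      simp only [ha, if_true]
      split_ifs <;> omega
    · have h1 := hs a (by simpa using ha)
      simp only [ha, if_false]
      omega
  · intro a j k hjk
    have hjk' : (j : ℕ) < k := hjk
    have h1 := hget a j
    have h2 := hget a k
    have ha : a ∈ S := by grind
    have hj : (j : ℕ) = 0 := by grind
    have hk : (k : ℕ) ≠ 0 := by omega
    have h1 := hr a ha
    have h2 := hq a ha
    have h3 := hcN a ha
    simp only [ha, hj, hk, if_true, if_false]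
    omega
  · intro a b j k hjk ht
    have hla := hload ((ω a).get j)
    rcases hget a j with ⟨ha, hj, hfa⟩ | ⟨ha, hj, hfa⟩ | ⟨ha, hj, hfa⟩ <;>
    rcases hget b k with ⟨hb, hk, hfb⟩ | ⟨hb, hk, hfb⟩ | ⟨hb, hk, hfb⟩ <;>
    rw [hfa, hfb] at hjk <;> rw [hfa] at hla <;>
    simp only [ha, hb, hj, hk, if_true, if_false, one_ne_zero] at ht ⊢
    · exact ⟨(hs a (mem_compl.2 ha)).2.2 b (mem_compl.2 hb) hjk (by rw [hjk] at ht; omega), trivial⟩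
    · have := (hr b hb).1
      rw [← hjk] at this
      omega
    · have := (hq b hb).1
      have := (hs a (mem_compl.2 ha)).1
      simp only [← hjk] at *
      omega
    · have := (hr a ha).1
      rw [hjk] at this
      omega
    · exact ⟨(hr a ha).2.2 b hb hjk (by omega), trivial⟩
    · have := (hr a ha).1
      have := (hq b hb).1
      simp only [← hjk] at *
      omega
    · have := (hq a ha).1
      have := (hs b (mem_compl.2 hb)).1
      simp only [← hjk] at *
      omega
    · have := (hq a ha).1
      have := (hr b hb).1
      simp only [← hjk] at *
      omega
    · have := (hq a ha).1
      have := (hq b hb).1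
      exact ⟨(hq a ha).2.2 b hb hjk (by simp only [← hjk] at *; omega), trivial⟩

/-- Fact 2, from [6]. Let `(ω_a)` be a finite family of words of length
1 or 2 over a finite alphabet `F`, let `load(f)` be the number of occurrences of `f`, and
`L = max_f load(f) ≥ 1`. Call `f` bad if `load f = L`, `f` is in no word of length 1, and
`f` never occurs as a first letter or never occurs as a second letter of the length-2
words. If no factor is bad, the minimum time of a schedule is `L`; if some factor is bad,
it is `L + 1`. -/
theorem diameter_two_minimum_schedule
    {F : Type*} [Fintype F] [DecidableEq F] {ι : Type*} [Fintype ι]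
    (ω : ι → List F)
    (hlen : ∀ a : ι, (ω a).length = 1 ∨ (ω a).length = 2)
    (load : F → ℕ) (hload : ∀ f : F, load f = ∑ a : ι, (ω a).count f)
    (L : ℕ) (hL : L = Finset.univ.sup load) (hL1 : 1 ≤ L)
    (Bad : F → Prop)
    (hBad : ∀ f : F, Bad f ↔
      (load f = L ∧ (∀ a : ι, (ω a).length = 1 → f ∉ ω a) ∧
        ((∀ a : ι, (ω a).length = 2 → (ω a)[0]? ≠ some f) ∨
         (∀ a : ι, (ω a).length = 2 → (ω a)[1]? ≠ some f)))) :
    ((¬ ∃ f : F, Bad f) → IsLeast {T : ℕ | HasSchedule ω T} L) ∧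
    ((∃ f : F, Bad f) → IsLeast {T : ℕ | HasSchedule ω T} (L + 1)) := by
  classical
  have hxy : ∀ a, ∃ u v, ω a = if (ω a).length = 2 then [u, v] else [u] := by
    intro a
    rcases hlen a with h | h
    · obtain ⟨u, hu⟩ := List.length_eq_one_iff.1 h
      exact ⟨u, u, by simp [hu]⟩
    · obtain ⟨u, v, huv⟩ := List.length_eq_two.1 h
      exact ⟨u, v, by simp [huv]⟩
  choose x y hω using hxy
  set S : Finset ι := {a | (ω a).length = 2} with hS
  have hmem : ∀ a, a ∈ S ↔ (ω a).length = 2 := by simp [hS]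
  have hωS : ∀ a, ω a = if a ∈ S then [x a, y a] else [x a] := by
    intro a
    simpa only [hmem] using hω a
  have hle : ∀ f, load f ≤ L := fun f => hL ▸ Finset.le_sup (Finset.mem_univ f)
  have hsplit : ∀ f, load f = (S.filter fun a => x a = f).card + (S.filter fun a => y a = f).card +
      (Sᶜ.filter fun a => x a = f).card := by
    intro f
    simp only [hload, Finset.card_filter]
    rw [← Finset.sum_add_sum_compl S, ← Finset.sum_add_distrib]
    congr 1
    · refine Finset.sum_congr rfl fun a ha => ?_
      rw [hωS a, if_pos ha]
      simp [List.count_cons, add_comm]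
    · refine Finset.sum_congr rfl fun a ha => ?_
      rw [hωS a, if_neg (Finset.mem_compl.1 ha)]
      simp [List.count_cons]
  refine ⟨fun hno => ⟨?_, ?_⟩, fun hbad => ⟨?_, ?_⟩⟩
  · obtain ⟨N, rfl⟩ : ∃ N, L = N + 1 := ⟨L - 1, by omega⟩
    have hone : ∀ f, (Sᶜ.filter fun a => x a = f).card = 0 →
        ∀ a, (ω a).length = 1 → f ∉ ω a := by
      intro f hf a ha hfa
      have haS : a ∉ S := by rw [hmem]; omega
      rw [hωS a, if_neg haS, List.mem_singleton] at hfa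
      exact Finset.filter_eq_empty_iff.1 (Finset.card_eq_zero.1 hf)
        (Finset.mem_compl.2 haS) hfa.symm
    refine hasSchedule_succ ω x y S hωS N (fun f => hsplit f ▸ hle f) (fun f => ?_) (fun f => ?_)
    · by_contra! hlt
      have h1 := hsplit f
      have h2 := hle f
      refine hno ⟨f, (hBad f).2 ⟨by omega, hone f (by omega), .inr fun a ha hfa => ?_⟩⟩
      rw [hωS a, if_pos ((hmem a).2 ha)] at hfa
      have h3 : (S.filter fun a => y a = f).card = 0 := by omega
      exact Finset.filter_eq_empty_iff.1 (Finset.card_eq_zero.1 h3) ((hmem a).2 ha)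
        (by simpa using hfa)
    · by_contra! hlt
      have h1 := hsplit f
      have h2 := hle f
      refine hno ⟨f, (hBad f).2 ⟨by omega, hone f (by omega), .inl fun a ha hfa => ?_⟩⟩
      rw [hωS a, if_pos ((hmem a).2 ha)] at hfa
      have h3 : (S.filter fun a => x a = f).card = 0 := by omega
      exact Finset.filter_eq_empty_iff.1 (Finset.card_eq_zero.1 h3) ((hmem a).2 ha)
        (by simpa using hfa)
  · rintro T ⟨t, htT, -, hinj⟩
    rw [hL]
    refine Finset.sup_le fun f _ => ?_
    rw [hload]
    exact sum_count_le_of_times_mem_Icc ω t hinj f 1 T fun a i _ => htT a i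
  · refine hasSchedule_succ ω x y S hωS L (fun f => ?_) (fun f => ?_) (fun f => ?_) <;>
    · have h1 := hsplit f
      have h2 := hle f
      omega
  · rintro T ⟨t, htT, hmono, hinj⟩
    obtain ⟨f, hf⟩ := hbad
    obtain ⟨hfL, hone, hpos⟩ := (hBad f).1 hf
    have htwo : ∀ a (j : Fin (ω a).length), (ω a).get j = f → (ω a).length = 2 := fun a j hj =>
      (hlen a).resolve_left fun h => hone a h (hj ▸ List.get_mem _ _)
    have hget : ∀ a (j : Fin (ω a).length), (ω a).get j = f → (ω a)[(j : ℕ)]? = some f :=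
      fun a j hj => by simpa using hj
    rw [hload] at hfL
    rcases hpos with hpos | hpos
    · have := sum_count_le_of_times_mem_Icc ω t hinj f 2 T fun a j hj => by
        have h2 := htwo a j hj
        have hj0 : (j : ℕ) ≠ 0 := fun h0 => hpos a h2 (h0 ▸ hget a j hj)
        have h3 : t a ⟨0, by omega⟩ < t a j := hmono a (Fin.lt_def.2 (by simp; omega))
        have h4 := htT a ⟨0, by omega⟩
        exact ⟨by omega, (htT a j).2⟩
      omega
    · have := sum_count_le_of_times_mem_Icc ω t hinj f 1 (T - 1) fun a j hj => by
        have h2 := htwo a j hj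
        have hj1 : (j : ℕ) ≠ 1 := fun h1 => hpos a h2 (h1 ▸ hget a j hj)
        have h3 : t a j < t a ⟨1, by omega⟩ :=
          hmono a (Fin.lt_def.2 (by have := j.isLt; simp; omega))
        have h4 := htT a ⟨1, by omega⟩
        exact ⟨(htT a j).1, by omega⟩
      omega
end

section
/- Let Δ be a finite set of size d ≥ 1 (the generators) and I a finite set of size n₂ (indexing the layer-2 vertices), with functions x, y : I → Δ giving for each i ∈ I the representation x_i y_i as a word of length two. Let M(δ) = |{i : x_i = δ}| and N(δ) = |{i : y_i = δ}|, and set θ = ⌈2n₂/d⌉ + 1. If M(δ) + N(δ) ≤ θ − 1 for every δ ∈ Δ, then there exists a schedule of time θ: functions t₀ : Δ → {1, …, θ} and t₁, t₂ : I → {1, …, θ} with t₁(i) < t₂(i) for all i ∈ I, such that for each δ ∈ Δ the times assigned to all occurrences of δ — namely t₀(δ) together with t₁(i) for each i with x_i = δ and t₂(i) for each i with y_i = δ — are pairwise distinct. -/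
open Finset in
/-- A regular bipartite multigraph whose two sides are both indexed by `V` has a perfect
matching. The edges are the elements of `s`, the edge `e` joining `x e` to `y e`. -/
theorem exists_perfect_matching_of_regular_s9 {V E : Type*} [Fintype V] [DecidableEq V]
    (x y : E → V) (k : ℕ) (s : Finset E)
    (hx : ∀ v, (s.filter fun e => x e = v).card = k + 1)
    (hy : ∀ v, (s.filter fun e => y e = v).card = k + 1) :
    ∃ m : V → E, (∀ v, m v ∈ s) ∧ (∀ v, x (m v) = v) ∧
      Function.Bijective fun v => y (m v) := by
  classical
  have hall : ∀ A : Finset V,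
      A.card ≤ (A.biUnion fun v => (s.filter fun e => x e = v).image y).card := by
    intro A
    set B := A.biUnion fun v => (s.filter fun e => x e = v).image y with hB
    have hA : (s.filter fun e => x e ∈ A).card = A.card * (k + 1) := by
      rw [card_eq_sum_card_fiberwise (f := x) (t := A) (by intro e he; simp_all)]
      rw [← smul_eq_mul, ← sum_const]
      refine sum_congr rfl fun v hv => ?_
      rw [← hx v, filter_filter]
      congr 1
      ext e
      simp only [mem_filter]
      grind
    have hB' : (s.filter fun e => y e ∈ B).card = B.card * (k + 1) := by
      rw [card_eq_sum_card_fiberwise (f := y) (t := B) (by intro e he; simp_all)]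
      rw [← smul_eq_mul, ← sum_const]
      refine sum_congr rfl fun v hv => ?_
      rw [← hy v, filter_filter]
      congr 1
      ext e
      simp only [mem_filter]
      grind
    have hsub : (s.filter fun e => x e ∈ A) ⊆ s.filter fun e => y e ∈ B := by
      intro e he
      simp only [mem_filter] at he
      simp only [hB, mem_filter, mem_biUnion, mem_image]
      exact ⟨he.1, x e, he.2, e, ⟨he.1, rfl⟩, rfl⟩
    have := card_le_card hsub
    rw [hA, hB'] at this
    exact Nat.le_of_mul_le_mul_right this k.succ_pos
  obtain ⟨f, hf, hft⟩ := (all_card_le_biUnion_card_iff_exists_injective _).1 hall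
  simp only [mem_image, mem_filter] at hft
  choose m hm hmy using hft
  refine ⟨m, fun v => (hm v).1, fun v => (hm v).2, ?_⟩
  simp only [hmy]
  exact Finite.injective_iff_bijective.1 hf

open Finset in
/-- A `k`-regular bipartite multigraph whose two sides are both indexed by `V` has a proper
edge colouring with `k` colours. -/
theorem exists_edge_colouring_of_regular {V E : Type*} [Fintype V] [DecidableEq V]
    (x y : E → V) (k : ℕ) (s : Finset E)
    (hx : ∀ v, (s.filter fun e => x e = v).card = k)
    (hy : ∀ v, (s.filter fun e => y e = v).card = k) :
    ∃ c : E → ℕ, (∀ e ∈ s, c e < k) ∧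
      (∀ e ∈ s, ∀ f ∈ s, x e = x f → c e = c f → e = f) ∧
      (∀ e ∈ s, ∀ f ∈ s, y e = y f → c e = c f → e = f) := by
  classical
  induction k generalizing s with
  | zero =>
    have hs : ∀ e, e ∉ s := fun e he => by
      have := hx (x e)
      rw [card_eq_zero, filter_eq_empty_iff] at this
      exact this he rfl
    exact ⟨fun _ => 0, by grind⟩
  | succ k ih =>
    obtain ⟨m, hms, hmx, hmy⟩ := exists_perfect_matching_of_regular_s9 x y k s hx hy
    set t := s.filter fun e => e ≠ m (x e) with ht
    have htx : ∀ v, (t.filter fun e => x e = v).card = k := by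
      intro v
      have : (t.filter fun e => x e = v) = (s.filter fun e => x e = v).erase (m v) := by
        ext e
        simp only [ht, mem_filter, mem_erase]
        grind
      rw [this, card_erase_of_mem (by simp [hms, hmx]), hx]
      rfl
    have hty : ∀ v, (t.filter fun e => y e = v).card = k := by
      intro v
      obtain ⟨u, hu⟩ := hmy.2 v
      have hu : y (m u) = v := hu
      have : (t.filter fun e => y e = v) = (s.filter fun e => y e = v).erase (m u) := by
        ext e
        simp only [ht, mem_filter, mem_erase]
        have hinj : y (m (x e)) = y (m u) → x e = u := fun h => hmy.1 h
        grind
      rw [this, card_erase_of_mem (by simp [hms, hu]), hy]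
      rfl
    obtain ⟨c, hc, hcx, hcy⟩ := ih t htx hty
    have hinj : ∀ u v, y (m u) = y (m v) → u = v := fun u v h => hmy.1 h
    have hmem : ∀ e ∈ s, e ≠ m (x e) → e ∈ t := fun e he h => mem_filter.2 ⟨he, h⟩
    refine ⟨fun e => if e = m (x e) then k else c e, ?_, ?_, ?_⟩
    · intro e he
      grind
    · intro e he f hf
      grind
    · intro e he f hf
      grind

open Finset in
/-- **Kőnig's edge colouring theorem** for bipartite multigraphs whose two sides are both indexed
by `V`: if all degrees are at most `k`, then `k` colours suffice. -/
theorem exists_edge_colouring_of_degree_le {V E : Type*} [Fintype V] [DecidableEq V]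
    [Fintype E] (x y : E → V) (k : ℕ)
    (hx : ∀ v, (univ.filter fun e => x e = v).card ≤ k)
    (hy : ∀ v, (univ.filter fun e => y e = v).card ≤ k) :
    ∃ c : E → ℕ, (∀ e, c e < k) ∧
      (∀ e f, x e = x f → c e = c f → e = f) ∧
      (∀ e f, y e = y f → c e = c f → e = f) := by
  classical
  let P (z : E → V) := Σ v, Fin (k - (univ.filter fun e => z e = v).card)
  have hP (z : E → V) (hz : ∀ v, (univ.filter fun e => z e = v).card ≤ k) :
      Fintype.card (P z) + Fintype.card E = Fintype.card V * k := by
    rw [Fintype.card_sigma, ← card_univ (α := E),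
      card_eq_sum_card_fiberwise (f := z) (t := univ) (by simp), ← sum_add_distrib,
      ← card_univ, ← smul_eq_mul, ← sum_const]
    refine sum_congr rfl fun v _ => ?_
    have := hz v
    simp only [Fintype.card_fin]
    omega
  have hfib (z : E → V) (v : V) : (univ.filter fun p : P z => p.1 = v).card =
      k - (univ.filter fun e => z e = v).card := by
    rw [← Fintype.card_subtype, Fintype.card_congr (Equiv.sigmaSubtype v), Fintype.card_fin]
  let φ : P x ≃ P y := Fintype.equivOfCardEq (by have := hP x hx; have := hP y hy; omega)
  have hsum (z : E → V) (w : P x → V) (v : V) :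
      (univ.filter fun e : E ⊕ P x => Sum.elim z w e = v).card =
        (univ.filter fun e => z e = v).card + (univ.filter fun p => w p = v).card := by
    simp only [card_filter, Fintype.sum_sum_type, Sum.elim_inl, Sum.elim_inr]
    rfl
  obtain ⟨c, hc, hcx, hcy⟩ := exists_edge_colouring_of_regular
    (Sum.elim x fun p : P x => p.1) (Sum.elim y fun p : P x => (φ p).1) k univ
    (fun v => by rw [hsum, hfib]; have := hx v; omega)
    (fun v => by
      have h : (univ.filter fun p : P x => (φ p).1 = v).card =
          (univ.filter fun p : P y => p.1 = v).card :=
        card_equiv φ (by simp)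
      rw [hsum, h, hfib]; have := hy v; omega)
  exact ⟨fun e => c (Sum.inl e), fun e => hc _ (mem_univ _),
    fun e f h h' => Sum.inl_injective (hcx _ (mem_univ _) _ (mem_univ _) h h'),
    fun e f h h' => Sum.inl_injective (hcy _ (mem_univ _) _ (mem_univ _) h h')⟩


/-- Theorem 5, schedule construction. Let `Δ` be a set of `d ≥ 1`
generators and `I` a set of `n₂` layer-2 indices with representations `x_i y_i`
(`x, y : I → Δ`). Let `M(δ) = |{i : x_i = δ}|`, `N(δ) = |{i : y_i = δ}|` and
`θ = ⌈2n₂/d⌉ + 1`. If `M(δ) + N(δ) ≤ θ − 1` for all `δ`, then there is a schedule of time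
`θ`: times `t₀(δ)` for the length-one words and `t₁(i) < t₂(i)` for the length-two words,
all in `{1, …, θ}`, such that for each `δ` all the times of occurrences of `δ`
(`t₀(δ)`, the `t₁(i)` with `x_i = δ` and the `t₂(i)` with `y_i = δ`) are pairwise
distinct. -/
theorem diameter_two_optimal_schedule
    {Δ : Type*} [Fintype Δ] [DecidableEq Δ] {I : Type*} [Fintype I]
    (d : ℕ) (hd : 1 ≤ d) (hcard : Fintype.card Δ = d)
    (n₂ : ℕ) (hn₂ : Fintype.card I = n₂)
    (x y : I → Δ)
    (M N : Δ → ℕ)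
    (hM : ∀ δ : Δ, M δ = (Finset.univ.filter fun i : I => x i = δ).card)
    (hN : ∀ δ : Δ, N δ = (Finset.univ.filter fun i : I => y i = δ).card)
    (θ : ℕ) (hθ : θ = (2 * n₂ + d - 1) / d + 1)
    (hbound : ∀ δ : Δ, M δ + N δ ≤ θ - 1) :
    ∃ (t₀ : Δ → ℕ) (t₁ t₂ : I → ℕ),
      (∀ δ : Δ, 1 ≤ t₀ δ ∧ t₀ δ ≤ θ) ∧
      (∀ i : I, 1 ≤ t₁ i ∧ t₁ i ≤ θ) ∧
      (∀ i : I, 1 ≤ t₂ i ∧ t₂ i ≤ θ) ∧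
      (∀ i : I, t₁ i < t₂ i) ∧
      (∀ i : I, t₁ i ≠ t₀ (x i)) ∧
      (∀ i : I, t₂ i ≠ t₀ (y i)) ∧
      (∀ i j : I, x i = x j → t₁ i = t₁ j → i = j) ∧
      (∀ i j : I, y i = y j → t₂ i = t₂ j → i = j) ∧
      (∀ i j : I, x i = y j → t₁ i ≠ t₂ j) := by
  classical
  obtain ⟨k, rfl⟩ : ∃ k, θ = k + 1 := ⟨_, hθ⟩
  clear hθ
  simp only [Nat.add_sub_cancel] at hbound
  obtain ⟨c, hc, hcx, hcy⟩ := exists_edge_colouring_of_degree_le x y k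
    (fun v => by rw [← hM]; have := hbound v; omega)
    (fun v => by rw [← hN]; have := hbound v; omega)
  let A (i : I) := Finset.univ.filter fun j => x j = x i ∧ c j ≤ c i
  let B (i : I) := Finset.univ.filter fun j => y j = y i ∧ c i ≤ c j
  have hA_pos (i : I) : 1 ≤ (A i).card := Finset.card_pos.2 ⟨i, by simp [A]⟩
  have hB_pos (i : I) : 1 ≤ (B i).card := Finset.card_pos.2 ⟨i, by simp [B]⟩
  have hA_le (i : I) : (A i).card ≤ M (x i) := by
    rw [hM]
    exact Finset.card_le_card fun j => by simp +contextual [A]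
  have hB_le (i : I) : (B i).card ≤ N (y i) := by
    rw [hN]
    exact Finset.card_le_card fun j => by simp +contextual [B]
  have hA_colour (i : I) : (A i).card ≤ c i + 1 := by
    rw [← Finset.card_range (c i + 1)]
    refine Finset.card_le_card_of_injOn c (fun j hj => ?_) fun j hj l hl => ?_
    · simp [A] at hj ⊢; omega
    · simp [A] at hj hl
      exact hcx j l (hj.1.trans hl.1.symm)
  have hB_colour (i : I) : (B i).card ≤ k - c i := by
    rw [← Nat.card_Ico]
    refine Finset.card_le_card_of_injOn c (fun j hj => ?_) fun j hj l hl => ?_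
    · simp [B] at hj ⊢; exact ⟨hj.2, hc j⟩
    · simp [B] at hj hl
      exact hcy j l (hj.1.trans hl.1.symm)
  have hA_lt (i j : I) (h : x i = x j) (hij : c i < c j) : (A i).card < (A j).card := by
    refine Finset.card_lt_card (Finset.ssubset_iff_of_subset ?_ |>.2 ⟨j, ?_, ?_⟩)
    · intro l hl; simp [A] at hl ⊢; exact ⟨hl.1.trans h, by omega⟩
    · simp [A]
    · simp [A, hij]
  have hB_lt (i j : I) (h : y i = y j) (hij : c i < c j) : (B j).card < (B i).card := by
    refine Finset.card_lt_card (Finset.ssubset_iff_of_subset ?_ |>.2 ⟨i, ?_, ?_⟩)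
    · intro l hl; simp [B] at hl ⊢; exact ⟨hl.1.trans h.symm, by omega⟩
    · simp [B]
    · simp [B, hij]
  refine ⟨fun δ => M δ + 1, fun i => (A i).card, fun i => k + 2 - (B i).card,
    fun δ => ?_, fun i => ?_, fun i => ?_, fun i => ?_, fun i => ?_, fun i => ?_,
    fun i j h h' => ?_, fun i j h h' => ?_, fun i j h => ?_⟩ <;> dsimp only at *
  · have := hbound δ; omega
  · have := hbound (x i); have := hA_pos i; have := hA_le i; omega
  · have := hbound (y i); have := hB_pos i; have := hB_le i; omega
  · have := hA_colour i; have := hB_colour i; have := hc i; omega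
  · have := hA_le i; omega
  · have := hB_le i; have := hbound (y i); omega
  · refine hcx i j h ?_
    rcases lt_trichotomy (c i) (c j) with hlt | heq | hgt
    · have := hA_lt i j h hlt; omega
    · exact heq
    · have := hA_lt j i h.symm hgt; omega
  · refine hcy i j h ?_
    have := hB_le i; have := hB_le j; have := hbound (y i); have := hbound (y j)
    rcases lt_trichotomy (c i) (c j) with hlt | heq | hgt
    · have := hB_lt i j h hlt; omega
    · exact heq
    · have := hB_lt j i h.symm hgt; omega
  · have := hA_le i; have := hB_le j; have := hbound (y j)
    rw [h] at *
    omega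
end

section
/- Let Δ be a finite set of size d ≥ 1 and I a finite set, with functions x, y : I → Δ. Let M(δ) = |{i : x_i = δ}|, N(δ) = |{i : y_i = δ}|, and T = 1 + max_{δ ∈ Δ} (M(δ) + N(δ)). Then there exists a schedule of time T: functions t₀ : Δ → {1, …, T} and t₁, t₂ : I → {1, …, T} with t₁(i) < t₂(i) for all i ∈ I, such that for each δ ∈ Δ the times t₀(δ), the times t₁(i) for i with x_i = δ, and the times t₂(i) for i with y_i = δ are pairwise distinct. -/
open Finset in
/-- A regular bipartite multigraph of positive degree has a perfect matching. The edges are the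
elements of `s`, with left and right endpoints given by `x` and `y`. -/
theorem exists_perfectMatching_of_regular {V E : Type*} [Fintype V] [DecidableEq V]
    (x y : E → V) (s : Finset E) {k : ℕ} (hk : 0 < k)
    (hx : ∀ v, #{e ∈ s | x e = v} = k) (hy : ∀ v, #{e ∈ s | y e = v} = k) :
    ∃ m : V → E, (∀ v, m v ∈ s) ∧ (∀ v, x (m v) = v) ∧ Function.Bijective (y ∘ m) := by
  classical
  have hall : ∀ A : Finset V, #A ≤ #(A.biUnion fun v => {e ∈ s | x e = v}.image y) := by
    intro A
    set B := A.biUnion fun v => {e ∈ s | x e = v}.image y with hB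
    have hA : #{e ∈ s | x e ∈ A} = #A * k := by
      rw [card_eq_sum_card_fiberwise (f := x) (t := A) (fun e he => by simp_all)]
      rw [sum_congr rfl (g := fun _ => k), sum_const, smul_eq_mul]
      intro v hv
      rw [← hx v, filter_filter]
      congr 1; ext e; simp; grind
    have hBk : #{e ∈ s | y e ∈ B} = #B * k := by
      rw [card_eq_sum_card_fiberwise (f := y) (t := B) (fun e he => by simp_all)]
      rw [sum_congr rfl (g := fun _ => k), sum_const, smul_eq_mul]
      intro v hv
      rw [← hy v, filter_filter]
      congr 1; ext e; simp; grind
    have hle : #{e ∈ s | x e ∈ A} ≤ #{e ∈ s | y e ∈ B} := by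
      refine card_le_card fun e he => ?_
      simp only [mem_filter] at he ⊢
      refine ⟨he.1, mem_biUnion.2 ⟨x e, he.2, mem_image.2 ⟨e, ?_, rfl⟩⟩⟩
      simp [he.1]
    rw [hA, hBk] at hle
    exact Nat.le_of_mul_le_mul_right hle hk
  obtain ⟨f, hf, hmem⟩ := (all_card_le_biUnion_card_iff_exists_injective _).1 hall
  simp only [mem_image, mem_filter] at hmem
  choose m hm hmf using hmem
  refine ⟨m, fun v => (hm v).1, fun v => (hm v).2, ?_⟩
  rw [show y ∘ m = f from funext hmf]
  exact Finite.injective_iff_bijective.1 hf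

open Finset in
/-- König's edge colouring theorem for regular bipartite multigraphs. -/
theorem exists_edgeColoring_of_regular {V E : Type*} [Fintype V] [DecidableEq V]
    (x y : E → V) (k : ℕ) (s : Finset E)
    (hx : ∀ v, #{e ∈ s | x e = v} = k) (hy : ∀ v, #{e ∈ s | y e = v} = k) :
    ∃ c : E → ℕ, (∀ e ∈ s, c e < k) ∧
      (∀ e ∈ s, ∀ e' ∈ s, x e = x e' → c e = c e' → e = e') ∧
      (∀ e ∈ s, ∀ e' ∈ s, y e = y e' → c e = c e' → e = e') := by
  classical
  induction k generalizing s with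
  | zero =>
    have hs : ∀ e, e ∉ s := fun e he => by
      have := hx (x e)
      rw [card_eq_zero, filter_eq_empty_iff] at this
      exact this he rfl
    exact ⟨fun _ => 0, by simp [hs], by simp [hs], by simp [hs]⟩
  | succ k ih =>
    obtain ⟨m, hms, hmx, hmy⟩ := exists_perfectMatching_of_regular x y s k.succ_pos hx hy
    have hx' : ∀ v, #{e ∈ s \ univ.image m | x e = v} = k := by
      intro v
      have : {e ∈ s \ univ.image m | x e = v} = {e ∈ s | x e = v}.erase (m v) := by
        ext e; simp only [mem_filter, mem_sdiff, mem_image, mem_univ, true_and, mem_erase]; grind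
      rw [this, card_erase_of_mem (by simp [hms, hmx]), hx, Nat.add_sub_cancel]
    have hy' : ∀ v, #{e ∈ s \ univ.image m | y e = v} = k := by
      intro v
      obtain ⟨w, rfl⟩ := hmy.2 v
      have : {e ∈ s \ univ.image m | y e = (y ∘ m) w} =
          {e ∈ s | y e = (y ∘ m) w}.erase (m w) := by
        ext e
        simp only [mem_filter, mem_sdiff, mem_image, mem_univ, true_and, mem_erase]
        constructor
        · grind
        · rintro ⟨h1, h2, h3⟩
          refine ⟨⟨h2, ?_⟩, h3⟩
          rintro ⟨u, rfl⟩
          exact h1 (congrArg m (hmy.1 h3))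
      rw [this, card_erase_of_mem (by simp [hms]), hy, Nat.add_sub_cancel]
    obtain ⟨c, hc, hcx, hcy⟩ := ih _ hx' hy'
    simp only [mem_sdiff, mem_image, mem_univ, true_and] at hc hcx hcy
    refine ⟨fun e => if ∃ v, m v = e then k else c e, ?_, ?_, ?_⟩
    · intro e he
      dsimp only
      split_ifs with h
      · omega
      · have := hc e ⟨he, h⟩; omega
    · intro e he e' he' hxe hce
      dsimp only at hce
      split_ifs at hce with h h' h'
      · obtain ⟨v, rfl⟩ := h
        obtain ⟨w, rfl⟩ := h'
        rw [hmx, hmx] at hxe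
        rw [hxe]
      · have := hc e' ⟨he', h'⟩; omega
      · have := hc e ⟨he, h⟩; omega
      · exact hcx e ⟨he, h⟩ e' ⟨he', h'⟩ hxe hce
    · intro e he e' he' hye hce
      dsimp only at hce
      split_ifs at hce with h h' h'
      · obtain ⟨v, rfl⟩ := h
        obtain ⟨w, rfl⟩ := h'
        exact congrArg m (hmy.1 hye)
      · have := hc e' ⟨he', h'⟩; omega
      · have := hc e ⟨he, h⟩; omega
      · exact hcy e ⟨he, h⟩ e' ⟨he', h'⟩ hye hce

open Finset in
/-- König's edge colouring theorem for bipartite multigraphs with both sides indexed by the same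
vertex set: if all degrees are at most `k`, then there is a proper edge colouring with `k`
colours. -/
theorem exists_edgeColoring_of_degree_le {V E : Type*} [Fintype V] [DecidableEq V] [Fintype E]
    (x y : E → V) (k : ℕ)
    (hx : ∀ v, #{e | x e = v} ≤ k) (hy : ∀ v, #{e | y e = v} ≤ k) :
    ∃ c : E → ℕ, (∀ e, c e < k) ∧
      (∀ e e', x e = x e' → c e = c e' → e = e') ∧
      (∀ e e', y e = y e' → c e = c e' → e = e') := by
  classical
  let P := Σ v : V, Fin (k - #{e | x e = v})
  let Q := Σ v : V, Fin (k - #{e | y e = v})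
  have hcard : Fintype.card P = Fintype.card Q := by
    have h1 : ∑ v, #{e | x e = v} = Fintype.card E :=
      (card_eq_sum_card_fiberwise (f := x) (t := univ) (by simp)).symm
    have h2 : ∑ v, #{e | y e = v} = Fintype.card E :=
      (card_eq_sum_card_fiberwise (f := y) (t := univ) (by simp)).symm
    simp only [P, Q, Fintype.card_sigma, Fintype.card_fin]
    have h3 : ∑ v, (k - #{e | x e = v}) + ∑ v, #{e | x e = v} = ∑ _v : V, k := by
      rw [← sum_add_distrib]
      exact sum_congr rfl fun v _ => Nat.sub_add_cancel (hx v)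
    have h4 : ∑ v, (k - #{e | y e = v}) + ∑ v, #{e | y e = v} = ∑ _v : V, k := by
      rw [← sum_add_distrib]
      exact sum_congr rfl fun v _ => Nat.sub_add_cancel (hy v)
    omega
  let φ : P ≃ Q := Fintype.equivOfCardEq hcard
  have hfib : ∀ (g : V → ℕ) (v : V), #{p : Σ v : V, Fin (g v) | p.1 = v} = g v := by
    intro g v
    rw [← Fintype.card_subtype, Fintype.card_congr (Equiv.sigmaSubtype v), Fintype.card_fin]
  have hsum : ∀ {F : Type _} [Fintype F] (f : E → V) (g : F → V) (v : V),
      #{e | Sum.elim f g e = v} = #{e | f e = v} + #{e | g e = v} := by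
    intro F _ f g v
    simp only [← Fintype.card_subtype]
    rw [Fintype.card_congr (Equiv.subtypeSum), Fintype.card_sum]
    simp only [Sum.elim_inl, Sum.elim_inr]
    congr!
  obtain ⟨c, hc, hcx, hcy⟩ := exists_edgeColoring_of_regular
    (Sum.elim x fun p : P => p.1) (Sum.elim y fun p : P => (φ p).1) k univ
    (fun v => by
      rw [hsum, hfib]
      exact Nat.add_sub_cancel' (hx v))
    (fun v => by
      have hφ : #{p : P | (φ p).1 = v} = #{q : Q | q.1 = v} :=
        card_equiv φ (by simp)
      rw [hsum, hφ, hfib]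
      exact Nat.add_sub_cancel' (hy v))
  exact ⟨fun e => c (.inl e), fun e => hc _ (mem_univ _),
    fun e e' h h' => Sum.inl_injective (hcx _ (mem_univ _) _ (mem_univ _) h h'),
    fun e e' h h' => Sum.inl_injective (hcy _ (mem_univ _) _ (mem_univ _) h h')⟩

open Finset in
/-- Ranking the members of each fibre of `f` by a function `c` that is injective on fibres. -/
theorem exists_fiberwise_rank {V E : Type*} [DecidableEq V] [Fintype E] (f : E → V) (c : E → ℕ)
    (hc : ∀ e e', f e = f e' → c e = c e' → e = e') :
    ∃ r : E → ℕ, (∀ e, 1 ≤ r e) ∧ (∀ e, r e ≤ #{e' | f e' = f e}) ∧ (∀ e, r e ≤ c e + 1) ∧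
      (∀ e e', f e = f e' → r e = r e' → e = e') := by
  classical
  have hlt : ∀ e e', f e = f e' → c e < c e' →
      #{j | f j = f e ∧ c j ≤ c e} < #{j | f j = f e' ∧ c j ≤ c e'} := by
    intro e e' h hlt
    refine card_lt_card (ssubset_iff_of_subset (fun j hj => ?_) |>.2 ⟨e', ?_, ?_⟩)
    · simp only [mem_filter, mem_univ, true_and] at hj ⊢
      exact ⟨hj.1.trans h, hj.2.trans hlt.le⟩
    · simp
    · simp [hlt]
  refine ⟨fun e => #{j | f j = f e ∧ c j ≤ c e}, fun e => ?_, fun e => ?_, fun e => ?_,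
    fun e e' h hr => ?_⟩
  · exact card_pos.2 ⟨e, by simp⟩
  · exact card_le_card fun j hj => by simp_all
  · rw [← card_range (c e + 1)]
    refine card_le_card_of_injOn c (fun j hj => ?_) (fun j hj j' hj' h => ?_)
    · simp only [coe_filter, mem_univ, true_and, Set.mem_ofPred_eq] at hj
      simp only [coe_range, Set.mem_Iio]
      omega
    · simp only [coe_filter, mem_univ, true_and, Set.mem_ofPred_eq] at hj hj'
      exact hc _ _ (hj.1.trans hj'.1.symm) h
  · rcases lt_trichotomy (c e) (c e') with h1 | h1 | h1
    · exact absurd hr (hlt _ _ h h1).ne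
    · exact hc _ _ h h1
    · exact absurd hr (hlt _ _ h.symm h1).ne'


/-- Corollary 6. Let `Δ` be a finite set of `d ≥ 1` generators, `I` a
finite set, and `x, y : I → Δ`. With `M(δ) = |{i : x_i = δ}|`, `N(δ) = |{i : y_i = δ}|`
and `T = 1 + max_δ (M(δ) + N(δ))`, there exists a schedule of time `T`: times `t₀(δ)` for
the length-one words and `t₁(i) < t₂(i)` for the length-two words, all in `{1, …, T}`,
such that for each `δ` all times of occurrences of `δ` (`t₀(δ)`, the `t₁(i)` with
`x_i = δ`, the `t₂(i)` with `y_i = δ`) are pairwise distinct. -/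
theorem diameter_two_schedule_upper_bound
    {Δ : Type*} [Fintype Δ] [DecidableEq Δ] {I : Type*} [Fintype I]
    (d : ℕ) (hd : 1 ≤ d) (hcard : Fintype.card Δ = d)
    (x y : I → Δ)
    (M N : Δ → ℕ)
    (hM : ∀ δ : Δ, M δ = (Finset.univ.filter fun i : I => x i = δ).card)
    (hN : ∀ δ : Δ, N δ = (Finset.univ.filter fun i : I => y i = δ).card)
    (T : ℕ) (hT : T = 1 + Finset.univ.sup (fun δ : Δ => M δ + N δ)) :
    ∃ (t₀ : Δ → ℕ) (t₁ t₂ : I → ℕ),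
      (∀ δ : Δ, 1 ≤ t₀ δ ∧ t₀ δ ≤ T) ∧
      (∀ i : I, 1 ≤ t₁ i ∧ t₁ i ≤ T) ∧
      (∀ i : I, 1 ≤ t₂ i ∧ t₂ i ≤ T) ∧
      (∀ i : I, t₁ i < t₂ i) ∧
      (∀ i : I, t₁ i ≠ t₀ (x i)) ∧
      (∀ i : I, t₂ i ≠ t₀ (y i)) ∧
      (∀ i j : I, x i = x j → t₁ i = t₁ j → i = j) ∧
      (∀ i j : I, y i = y j → t₂ i = t₂ j → i = j) ∧
      (∀ i j : I, x i = y j → t₁ i ≠ t₂ j) := by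
  set K := Finset.univ.sup (fun δ : Δ => M δ + N δ) with hK
  have hdeg : ∀ δ, M δ + N δ ≤ K := fun δ =>
    Finset.le_sup (f := fun δ : Δ => M δ + N δ) (Finset.mem_univ δ)
  obtain ⟨c, hc, hcx, hcy⟩ := exists_edgeColoring_of_degree_le x y K
    (fun δ => by have := hdeg δ; rw [← hM]; omega) (fun δ => by have := hdeg δ; rw [← hN]; omega)
  obtain ⟨a, ha1, haM, hac, hainj⟩ := exists_fiberwise_rank x c hcx
  obtain ⟨b, hb1, hbN, hbc, hbinj⟩ := exists_fiberwise_rank y (fun i => K - 1 - c i)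
    (fun i j h h' => hcy i j h (by have := hc i; have := hc j; omega))
  simp only [← hM] at haM
  simp only [← hN] at hbN
  refine ⟨fun δ => M δ + 1, a, fun i => T + 1 - b i, fun δ => ?_, fun i => ?_, fun i => ?_,
    fun i => ?_, fun i => ?_, fun i => ?_, hainj, fun i j h h' => hbinj i j h ?_,
    fun i j h => ?_⟩ <;> beta_reduce at *
  · have := hdeg δ
    omega
  · have := hdeg (x i); have := ha1 i; have := haM i
    omega
  · have := hdeg (y i); have := hb1 i; have := hbN i
    omega
  · have := hc i; have := hac i; have := hbc i
    omega
  · have := haM i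
    omega
  · have := hdeg (y i); have := hbN i
    omega
  · have := hdeg (y i); have := hdeg (y j); have := hbN i; have := hbN j
    omega
  · have := hdeg (y j); have := h ▸ haM i; have := hbN j
    omega
end
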